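/- arXiv:2212.04840 — 5 statements merged into one kernel-verified Lean document; each statement's English description precedes it below -/
import Mathlib

section
/- Let p > 6, μ > 0 and ℓ > 0. Then there exist a real number λ > 0 and a function u : ℝ → ℝ such that: u is continuously differentiable on ℝ and twice differentiable at every point of ℝ ∖ {0, ℓ}; u(x) > 0 for every x ∈ ℝ; u and u' are square-integrable on ℝ; ∫_ℝ u² dx = μ; −u''(x) + λ·u(x) = χ_{[0,ℓ]}(x)·u(x)^{p−1} for every x ∈ ℝ ∖ {0, ℓ}; and the energy level is strictly positive, i.e. (1/2)∫_ℝ |u'|² dx − (1/p)∫_0^ℓ u^p dx > 0. -/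
open MeasureTheory Set Filter


theorem inv_aux (f f' : ℝ → ℝ) (hf : ∀ x, HasDerivAt f (f' x) x) (hpos : ∀ x, 0 < f' x)
    (htop : Tendsto f atTop atTop) (hbot : Tendsto f atBot atBot) :
    ∃ g : ℝ → ℝ, Continuous g ∧ StrictMono g ∧ (∀ t, f (g t) = t) ∧ (∀ x, g (f x) = x) ∧
      ∀ t, HasDerivAt g (f' (g t))⁻¹ t := by
  have hmono : StrictMono f := strictMono_of_hasDerivAt_pos hf hpos
  have hc : Continuous f := continuous_iff_continuousAt.2 fun x => (hf x).continuousAt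
  have hs : Function.Surjective f := hc.surjective htop hbot
  let e := hmono.orderIsoOfSurjective f hs
  have he : ∀ x, e x = f x := fun x => rfl
  have h1 : ∀ t, f (e.symm t) = t := fun t => by rw [← he]; simp
  have h2 : ∀ x, e.symm (f x) = x := fun t => by rw [← he]; simp
  refine ⟨e.symm, e.symm.continuous, e.symm.strictMono, h1, h2, fun t => ?_⟩
  exact HasDerivAt.of_local_left_inverse e.symm.continuous.continuousAt (hf _) (hpos _).ne'
    (Eventually.of_forall h1)

theorem psi_aux (q : ℝ) (hq : 4 < q) :
    ∃ g : ℝ → ℝ, Continuous g ∧ StrictMono g ∧ g 0 = 0 ∧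
      (∀ t, Real.exp (q * g t) - Real.exp (-2 * g t) = t) ∧
      ∀ t, HasDerivAt g (q * Real.exp (q * g t) + 2 * Real.exp (-2 * g t))⁻¹ t := by
  obtain ⟨g, h1, h2, h3, h4, h5⟩ := inv_aux (fun z => Real.exp (q * z) - Real.exp (-2 * z))
    (fun z => q * Real.exp (q * z) + 2 * Real.exp (-2 * z)) (fun x => by
      have ha : HasDerivAt (fun z : ℝ => Real.exp (q * z)) (Real.exp (q * x) * (q * 1)) x :=
        ((hasDerivAt_id x).const_mul q).exp
      have hb : HasDerivAt (fun z : ℝ => Real.exp (-2 * z)) (Real.exp (-2 * x) * (-2 * 1)) x :=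
        ((hasDerivAt_id x).const_mul (-2)).exp
      exact (ha.sub hb).congr_deriv (by ring)) (fun x => by positivity) (by
      refine tendsto_atTop_mono' atTop (f₁ := fun z => q * z) ?_ ?_
      · filter_upwards [eventually_ge_atTop 0] with z hz
        have := Real.add_one_le_exp (q * z)
        have : Real.exp (-2 * z) ≤ 1 := Real.exp_le_one_iff.2 (by linarith)
        linarith
      · exact tendsto_id.const_mul_atTop (by linarith)) (by
      refine tendsto_atBot_mono' atBot (f₁ := fun z : ℝ => 2 * z) ?_ ?_
      · filter_upwards [eventually_le_atBot 0] with z hz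
        have := Real.add_one_le_exp (-2 * z)
        have : Real.exp (q * z) ≤ 1 := Real.exp_le_one_iff.2 (by nlinarith)
        linarith
      · exact tendsto_id.const_mul_atBot (by linarith))
  refine ⟨g, h1, h2, ?_, h3, h5⟩
  have := h4 0
  simpa using this

/-- clamp to [-1,1] -/
noncomputable def kap (w : ℝ) : ℝ := max (-1) (min 1 w)

theorem kap_cont : Continuous kap := by unfold kap; fun_prop
theorem kap_mid {w : ℝ} (h1 : -1 ≤ w) (h2 : w ≤ 1) : kap w = w := by
  unfold kap; rw [min_eq_right h2, max_eq_right h1]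
theorem kap_lo {w : ℝ} (h1 : w ≤ -1) : kap w = -1 := by
  unfold kap; rw [min_eq_right (by linarith), max_eq_left h1]
theorem kap_hi {w : ℝ} (h1 : 1 ≤ w) : kap w = 1 := by
  unfold kap; rw [min_eq_left h1, max_eq_right (by norm_num)]
theorem kap_sq (w : ℝ) : 0 ≤ 1 - kap w ^ 2 := by
  have h1 : -1 ≤ kap w := le_max_left _ _
  have h2 : kap w ≤ 1 := max_le (by norm_num) (min_le_left _ _)
  nlinarith

theorem stepA (q : ℝ) (hq : 4 < q) : ∃ Z F : ℝ → ℝ → ℝ,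
    Continuous (Function.uncurry Z) ∧ Continuous (Function.uncurry F) ∧
    (∀ α w, 0 < F α w) ∧ (∀ α w, 0 ≤ Z α w) ∧
    (∀ α w, F α w = Real.exp (q * (α + Z α w)) - (1 - kap w ^ 2)) ∧
    (∀ α w, F α w = q / 2 * (1 - kap w ^ 2) + Real.exp (q * α - 2 * Z α w)) ∧
    (∀ α w, w ≤ -1 → Z α w = 0) ∧ (∀ α w, 1 ≤ w → Z α w = 0) ∧
    (∀ α w, -1 < w → w < 1 → HasDerivAt (Z α) (-w / F α w) w) := by
  obtain ⟨g, hc, hm, h0, hg, hd⟩ := psi_aux q hq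
  set Z : ℝ → ℝ → ℝ := fun α w => g ((q / 2 + 1) * (1 - kap w ^ 2) * Real.exp (-(q * α))) with hZ
  set F : ℝ → ℝ → ℝ := fun α w => Real.exp (q * (α + Z α w)) - (1 - kap w ^ 2) with hF
  have hkc := kap_cont
  have hZc : Continuous (Function.uncurry Z) := by
    simp only [hZ, Function.uncurry_def]
    fun_prop
  have hZ0 : ∀ α w, 0 ≤ Z α w := fun α w => by
    rw [← h0]
    exact hm.monotone (mul_nonneg (mul_nonneg (by linarith) (kap_sq w)) (Real.exp_pos _).le)
  have key : ∀ α w, Real.exp (q * (α + Z α w)) - Real.exp (q * α - 2 * Z α w)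
      = (q / 2 + 1) * (1 - kap w ^ 2) := fun α w => by
    have := hg ((q / 2 + 1) * (1 - kap w ^ 2) * Real.exp (-(q * α)))
    have h2 : Real.exp (-(q * α)) * Real.exp (q * α) = 1 := by rw [← Real.exp_add]; simp
    have e1 : Real.exp (q * (α + Z α w)) = Real.exp (q * α) * Real.exp (q * Z α w) := by
      rw [← Real.exp_add]; ring_nf
    have e2 : Real.exp (q * α - 2 * Z α w) = Real.exp (q * α) * Real.exp (-2 * Z α w) := by
      rw [← Real.exp_add]; ring_nf
    rw [e1, e2, ← mul_sub]
    simp only [hZ]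
    rw [this]
    linear_combination (q / 2 + 1) * (1 - kap w ^ 2) * h2
  have hF2 : ∀ α w, F α w = q / 2 * (1 - kap w ^ 2) + Real.exp (q * α - 2 * Z α w) := by
    intro α w
    have := key α w
    simp only [hF]
    linarith
  have hFp : ∀ α w, 0 < F α w := fun α w => by
    rw [hF2]
    have := mul_nonneg (by linarith : 0 ≤ q / 2) (kap_sq w)
    have := Real.exp_pos (q * α - 2 * Z α w)
    linarith
  refine ⟨Z, F, hZc, ?_, hFp, hZ0, fun _ _ => rfl, hF2, ?_, ?_, ?_⟩
  · simp only [hF, Function.uncurry_def] at hZc ⊢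
    fun_prop
  · intro α w h
    simp only [hZ, kap_lo h]; simpa using h0
  · intro α w h
    simp only [hZ, kap_hi h]; simpa using h0
  · intro α w h1 h2
    have e : ∀ᶠ x in nhds w, (q / 2 + 1) * (1 - kap x ^ 2) * Real.exp (-(q * α))
        = (q / 2 + 1) * (1 - x ^ 2) * Real.exp (-(q * α)) := by
      filter_upwards [Ioo_mem_nhds h1 h2] with x hx
      rw [kap_mid hx.1.le hx.2.le]
    have d1 : HasDerivAt (fun x : ℝ => (q / 2 + 1) * (1 - x ^ 2) * Real.exp (-(q * α)))
        ((q / 2 + 1) * (-(2 * w)) * Real.exp (-(q * α))) w := by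
      have := ((hasDerivAt_pow 2 w).const_sub 1).const_mul (q / 2 + 1) |>.mul_const (Real.exp (-(q * α)))
      simpa using this
    have d2 := d1.congr_of_eventuallyEq e
    have d3 := (hd ((q / 2 + 1) * (1 - kap w ^ 2) * Real.exp (-(q * α)))).comp w d2
    refine d3.congr_deriv ?_
    have hk := key α w
    have hFF : F α w = Real.exp (q * (α + Z α w)) - (1 - kap w ^ 2) := rfl
    have e1 : Real.exp (q * (α + Z α w)) = Real.exp (q * α) * Real.exp (q * Z α w) := by
      rw [← Real.exp_add]; ring_nf
    have e2 : Real.exp (q * α - 2 * Z α w) = Real.exp (q * α) * Real.exp (-2 * Z α w) := by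
      rw [← Real.exp_add]; ring_nf
    change (q * Real.exp (q * Z α w) + 2 * Real.exp (-2 * Z α w))⁻¹ * _ = _
    have hD : 0 < q * Real.exp (q * Z α w) + 2 * Real.exp (-2 * Z α w) := by positivity
    have hE : Real.exp (-(q * α)) = (Real.exp (q * α))⁻¹ := Real.exp_neg _
    have h3 : (q + 2) * F α w = Real.exp (q * α) * (q * Real.exp (q * Z α w) + 2 * Real.exp (-2 * Z α w)) := by
      rw [e1, e2] at hk
      rw [hFF, e1]
      linear_combination 2 * hk
    rw [hE]
    have := hFp α w
    have := Real.exp_pos (q * α)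
    rw [inv_mul_eq_div, div_eq_div_iff hD.ne' (hFp α w).ne']
    generalize Real.exp (-2 * Z α w) = B at *
    field_simp
    linear_combination (-w) * h3


theorem stepB (q α : ℝ) (hq : 4 < q) (Z F : ℝ → ℝ) (hZc : Continuous Z) (hFc : Continuous F)
    (hFp : ∀ w, 0 < F w) (hZ0 : ∀ w, 0 ≤ Z w)
    (hF2 : ∀ w, F w = q / 2 * (1 - kap w ^ 2) + Real.exp (q * α - 2 * Z w))
    (hZl : ∀ w, w ≤ -1 → Z w = 0) (hZr : ∀ w, 1 ≤ w → Z w = 0)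
    (hZd : ∀ w, -1 < w → w < 1 → HasDerivAt Z (-w / F w) w)
    (L : ℝ) (hL : L = ∫ w in (-1 : ℝ)..1, 1 / F w) :
    ∃ v θ : ℝ → ℝ, 0 < L ∧ Continuous θ ∧ StrictMono θ ∧ θ 0 = -1 ∧ θ L = 1 ∧
      (∀ x, HasDerivAt θ (F (θ x)) x) ∧ (∀ x, HasDerivAt v (-kap (θ x) * v x) x) ∧
      (∀ x, 0 < v x) ∧
      (∀ x, 0 ≤ x → x ≤ L → v x = Real.exp (α + Z (θ x))) ∧
      (∀ x, x ≤ 0 → v x = Real.exp (α + x)) ∧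
      (∀ x, L ≤ x → v x = Real.exp (α - (x - L))) := by
  have hic : Continuous fun w => 1 / F w := continuous_const.div hFc fun w => (hFp w).ne'
  set X : ℝ → ℝ := fun θ => ∫ w in (-1 : ℝ)..θ, 1 / F w with hX
  have hXd : ∀ x, HasDerivAt X (1 / F x) x := fun x =>
    intervalIntegral.integral_hasDerivAt_right (hic.intervalIntegrable _ _)
      hic.aestronglyMeasurable.stronglyMeasurableAtFilter hic.continuousAt
  have hpos : ∀ x, 0 < 1 / F x := fun x => one_div_pos.2 (hFp x)
  set M := q / 2 + Real.exp (q * α) with hM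
  have hMp : 0 < M := by positivity
  have hFM : ∀ w, F w ≤ M := fun w => by
    rw [hF2]
    have h1 : Real.exp (q * α - 2 * Z w) ≤ Real.exp (q * α) :=
      Real.exp_le_exp.2 (by linarith [hZ0 w])
    have : q / 2 * (1 - kap w ^ 2) ≤ q / 2 := by nlinarith [sq_nonneg (kap w)]
    linarith
  have hlow : ∀ w, 1 / M ≤ 1 / F w := fun w => one_div_le_one_div_of_le (hFp w) (hFM w)
  have hm : Monotone fun x => X x - 1 / M * x := by
    apply monotone_of_deriv_nonneg
    · exact fun x => ((hXd x).sub ((hasDerivAt_id x).const_mul (1 / M))).differentiableAt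
    · intro x
      have := ((hXd x).sub ((hasDerivAt_id x).const_mul (1 / M))).deriv
      have h2 := hlow x
      change deriv (X - fun y => 1 / M * id y) x ≥ 0
      rw [this]
      simpa using h2
  have hMi : 0 < 1 / M := by positivity
  obtain ⟨θ, hc, hmono, h3, h4, hd⟩ := inv_aux X (fun w => 1 / F w) hXd hpos (by
      refine tendsto_atTop_mono' atTop (f₁ := fun z => 1 / M * z + X 0) ?_ ?_
      · filter_upwards [eventually_ge_atTop 0] with z hz
        have := hm hz
        simp only at this
        linarith
      · exact tendsto_atTop_add_const_right _ _ (tendsto_id.const_mul_atTop hMi)) (by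
      refine tendsto_atBot_mono' atBot (f₁ := fun z => 1 / M * z + X 0) ?_ ?_
      · filter_upwards [eventually_le_atBot 0] with z hz
        have := hm hz
        simp only at this
        linarith
      · exact tendsto_atBot_add_const_right _ _ (tendsto_id.const_mul_atBot hMi))
  have hX1 : X (-1) = 0 := by simp [hX]
  have hXL : X 1 = L := hL.symm
  have ht0 : θ 0 = -1 := by rw [← hX1, h4]
  have htL : θ L = 1 := by rw [← hXL, h4]
  have hLp : 0 < L := by
    rw [← hmono.lt_iff_lt, ht0, htL]; norm_num
  have hd' : ∀ x, HasDerivAt θ (F (θ x)) x := fun x => by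
    have := hd x
    simpa using this
  have hkc : Continuous fun x => kap (θ x) := kap_cont.comp hc
  set I : ℝ → ℝ := fun x => ∫ t in (0 : ℝ)..x, kap (θ t) with hI
  have hId : ∀ x, HasDerivAt I (kap (θ x)) x := fun x =>
    intervalIntegral.integral_hasDerivAt_right (hkc.intervalIntegrable _ _)
      hkc.aestronglyMeasurable.stronglyMeasurableAtFilter hkc.continuousAt
  have hIc : Continuous I := continuous_iff_continuousAt.2 fun x => (hId x).continuousAt
  have hI0 : I 0 = 0 := by simp [hI]
  have hmid : ∀ x, 0 ≤ x → x ≤ L → I x + Z (θ x) = 0 := by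
    intro x hx0 hxL
    rcases hx0.eq_or_lt with rfl | hx
    · rw [hI0, ht0, hZl _ le_rfl, add_zero]
    obtain ⟨c, hc1, hc2⟩ := exists_hasDerivAt_eq_slope (fun x => I x + Z (θ x)) (fun _ => 0) hx
      (by fun_prop) (by
        intro y hy
        have h1 : -1 < θ y := by rw [← ht0]; exact hmono hy.1
        have h2 : θ y < 1 := by rw [← htL]; exact hmono (hy.2.trans_le hxL)
        have := (hId y).add ((hZd _ h1 h2).comp y (hd' y))
        refine this.congr_deriv ?_
        rw [kap_mid h1.le h2.le]
        have := (hFp (θ y)).ne'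
        field_simp
        ring)
    have e0 : I 0 + Z (θ 0) = 0 := by rw [hI0, ht0, hZl _ le_rfl, add_zero]
    simp only [e0] at hc2
    have hx' : x - 0 ≠ 0 := by linarith
    rw [eq_div_iff hx'] at hc2
    linarith
  have hIL : I L = 0 := by
    have := hmid L hLp.le le_rfl
    rwa [htL, hZr _ le_rfl, add_zero] at this
  refine ⟨fun x => Real.exp (α - I x), θ, hLp, hc, hmono, ht0, htL, hd', ?_, ?_, ?_, ?_, ?_⟩
  · intro x
    have := ((hId x).const_sub α).exp
    exact this.congr_deriv (by ring)
  · intro x; exact Real.exp_pos _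
  · intro x h1 h2
    have := hmid x h1 h2
    simp only
    congr 1; linarith
  · intro x hx
    have : I x = -x := by
      have : I x = ∫ t in (0 : ℝ)..x, (-1 : ℝ) := by
        apply intervalIntegral.integral_congr
        intro t ht
        rw [uIcc_of_ge hx] at ht
        simp only
        apply kap_lo
        rw [← ht0]; exact hmono.monotone ht.2
      rw [this]; simp
    simp only [this]; congr 1; ring
  · intro x hx
    have : I x = x - L := by
      have h1 : I x = I L + ∫ t in L..x, kap (θ t) :=
        (intervalIntegral.integral_add_adjacent_intervals (hkc.intervalIntegrable _ _)
          (hkc.intervalIntegrable _ _)).symm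
      have : ∫ t in L..x, kap (θ t) = ∫ t in L..x, (1 : ℝ) := by
        apply intervalIntegral.integral_congr
        intro t ht
        rw [uIcc_of_le hx] at ht
        simp only
        apply kap_hi
        rw [← htL]; exact hmono.monotone ht.1
      rw [h1, hIL, this]; simp
    simp only [this]

theorem tails (f : ℝ → ℝ) (hf : Continuous f) (C L : ℝ) (hL : 0 < L)
    (h1 : ∀ x, x ≤ 0 → f x = C * Real.exp (2 * x))
    (h2 : ∀ x, L ≤ x → f x = C * Real.exp (-2 * (x - L))) :
    Integrable f ∧ ∫ x, f x = C + ∫ x in (0 : ℝ)..L, f x := by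
  have e1 : EqOn f (fun x => C * Real.exp (2 * x)) (Iic 0) := fun x hx => h1 x hx
  have e2 : EqOn f (fun x => C * Real.exp (2 * L) * Real.exp (-2 * x)) (Ioi L) := fun x hx => by
    rw [h2 x (le_of_lt hx)]
    simp only [mul_assoc, ← Real.exp_add]; ring_nf
  have i1 : IntegrableOn f (Iic 0) := by
    rw [integrableOn_congr_fun e1 measurableSet_Iic]
    exact (integrableOn_exp_mul_Iic (by norm_num) 0).const_mul C
  have i2 : IntegrableOn f (Ioi L) := by
    rw [integrableOn_congr_fun e2 measurableSet_Ioi]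
    exact (integrableOn_exp_mul_Ioi (by norm_num) L).const_mul _
  have i3 : IntegrableOn f (Ioc 0 L) := (hf.intervalIntegrable 0 L).1
  have i4 : IntegrableOn f (Ioi 0) := by
    rw [← Ioc_union_Ioi_eq_Ioi hL.le]; exact i3.union i2
  have i5 : Integrable f := by
    rw [← integrableOn_univ, ← Iic_union_Ioi (a := (0:ℝ))]; exact i1.union i4
  refine ⟨i5, ?_⟩
  rw [← intervalIntegral.integral_Iic_add_Ioi i1 i4, 
    ← intervalIntegral.integral_interval_add_Ioi i4 i2,
    setIntegral_congr_fun measurableSet_Iic e1, setIntegral_congr_fun measurableSet_Ioi e2,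
    integral_const_mul, integral_const_mul, integral_exp_mul_Iic (by norm_num),
    integral_exp_mul_Ioi (by norm_num)]
  have : Real.exp (2 * L) * Real.exp (-2 * L) = 1 := by rw [← Real.exp_add]; simp
  simp only [mul_zero, Real.exp_zero]
  linear_combination C / 2 * this


theorem stepC (q α : ℝ) (hq : 4 < q) (Z F : ℝ → ℝ) (hZc : Continuous Z) (hFc : Continuous F)
    (hFp : ∀ w, 0 < F w) (hZ0 : ∀ w, 0 ≤ Z w)
    (hF1 : ∀ w, F w = Real.exp (q * (α + Z w)) - (1 - kap w ^ 2))
    (hF2 : ∀ w, F w = q / 2 * (1 - kap w ^ 2) + Real.exp (q * α - 2 * Z w))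
    (hZl : ∀ w, w ≤ -1 → Z w = 0) (hZr : ∀ w, 1 ≤ w → Z w = 0)
    (hZd : ∀ w, -1 < w → w < 1 → HasDerivAt Z (-w / F w) w)
    (L : ℝ) (hL : L = ∫ w in (-1 : ℝ)..1, 1 / F w) :
    ∃ v v1 : ℝ → ℝ, 0 < L ∧ (∀ x, HasDerivAt v (v1 x) x) ∧ Continuous v1 ∧ (∀ x, 0 < v x) ∧
      (∀ x, x < 0 → HasDerivAt v1 (v x) x) ∧ (∀ x, L < x → HasDerivAt v1 (v x) x) ∧
      (∀ x, 0 < x → x < L → HasDerivAt v1 (v x - v x ^ (q + 1)) x) ∧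
      Integrable (fun x => v x ^ 2) ∧ Integrable (fun x => v1 x ^ 2) ∧
      ∫ x, v x ^ 2 = Real.exp (2 * α) + ∫ w in (-1 : ℝ)..1, Real.exp (2 * (α + Z w)) / F w ∧
      (∫ x, v x ^ 2 ≤ (2 / q + 1 / 2) * ∫ w in (-1 : ℝ)..1, Real.exp (2 * (α + Z w))) ∧
      0 < (1 / 2) * (∫ x, v1 x ^ 2) - (1 / (q + 2)) * ∫ x in (0 : ℝ)..L, v x ^ (q + 2) := by
  obtain ⟨v, θ, hLp, hθc, hmono, ht0, htL, hθd, hvd, hvp, hmid, hlo, hhi⟩ :=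
    stepB q α hq Z F hZc hFc hFp hZ0 hF2 hZl hZr hZd L hL
  have hkc := kap_cont
  have hvc : Continuous v := continuous_iff_continuousAt.2 fun x => (hvd x).continuousAt
  have klo : ∀ x, x ≤ 0 → kap (θ x) = -1 := fun x hx =>
    kap_lo (by rw [← ht0]; exact hmono.monotone hx)
  have khi : ∀ x, L ≤ x → kap (θ x) = 1 := fun x hx =>
    kap_hi (by rw [← htL]; exact hmono.monotone hx)
  have kmid : ∀ x, 0 ≤ x → x ≤ L → kap (θ x) = θ x := fun x h1 h2 =>
    kap_mid (by rw [← ht0]; exact hmono.monotone h1) (by rw [← htL]; exact hmono.monotone h2)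
  have hvq : ∀ x, 0 ≤ x → x ≤ L → v x ^ q = F (θ x) + (1 - kap (θ x) ^ 2) := by
    intro x h1 h2
    rw [hF1, hmid x h1 h2, ← Real.exp_mul, mul_comm q]; ring
  set v1 : ℝ → ℝ := fun x => -kap (θ x) * v x with hv1
  have hv1c : Continuous v1 := by simp only [hv1]; fun_prop
  have T1 := tails (fun x => v x ^ 2) (by fun_prop) (Real.exp (2 * α)) L hLp
    (fun x hx => by simp only [hlo x hx, ← Real.exp_add, ← Real.exp_nat_mul]; push_cast; ring_nf)
    (fun x hx => by simp only [hhi x hx, ← Real.exp_add, ← Real.exp_nat_mul]; push_cast; ring_nf)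
  have T2 := tails (fun x => v1 x ^ 2) (by fun_prop) (Real.exp (2 * α)) L hLp
    (fun x hx => by
      simp only [hv1, klo x hx, hlo x hx, neg_neg, one_mul, ← Real.exp_add, ← Real.exp_nat_mul]
      push_cast; ring_nf)
    (fun x hx => by
      simp only [hv1, khi x hx, hhi x hx, neg_mul, one_mul, neg_sq, ← Real.exp_add, ← Real.exp_nat_mul]
      push_cast; ring_nf)
  set A : ℝ → ℝ := fun x => F (θ x) * v x ^ 2 with hA
  set B : ℝ → ℝ := fun x => v1 x ^ 2 with hB
  have hAc : Continuous A := by simp only [hA]; fun_prop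
  have hBc : Continuous B := by simp only [hB]; fun_prop
  have hBnn : 0 ≤ ∫ x in (0 : ℝ)..L, B x :=
    intervalIntegral.integral_nonneg hLp.le fun x _ => sq_nonneg _
  have v0 : v 0 ^ 2 = Real.exp (2 * α) := by
    rw [hlo 0 le_rfl, ← Real.exp_nat_mul]; push_cast; ring_nf
  have vL : v L ^ 2 = Real.exp (2 * α) := by
    rw [hhi L le_rfl, ← Real.exp_nat_mul]; push_cast; ring_nf
  have id1 : (∫ x in (0 : ℝ)..L, A x) - 2 * (∫ x in (0 : ℝ)..L, B x) = 2 * Real.exp (2 * α) := by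
    have h := intervalIntegral.integral_eq_sub_of_hasDerivAt (a := 0) (b := L)
      (f := fun x => θ x * v x ^ 2) (f' := fun x => A x - 2 * B x) (by
        intro x hx
        rw [uIcc_of_le hLp.le] at hx
        have := (hθd x).mul ((hvd x).pow 2)
        refine this.congr_deriv ?_
        simp only [hA, hB, hv1, kmid x hx.1 hx.2, Pi.pow_apply]
        push_cast
        ring) ((by fun_prop : Continuous fun x => A x - 2 * B x).intervalIntegrable _ _)
    rw [intervalIntegral.integral_sub (hAc.intervalIntegrable _ _)
      ((by fun_prop : Continuous fun x => 2 * B x).intervalIntegrable _ _), intervalIntegral.integral_const_mul] at h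
    rw [h]
    simp only [ht0, htL, v0, vL]
    ring
  have hFs : ∀ w, 1 - kap w ^ 2 ≤ 2 / q * F w := fun w => by
    have h := hF2 w
    have := Real.exp_pos (q * α - 2 * Z w)
    rw [div_mul_eq_mul_div, le_div_iff₀ (by linarith)]
    linarith
  have cv1 : ∫ x in (0 : ℝ)..L, v x ^ 2 = ∫ w in (-1 : ℝ)..1, Real.exp (2 * (α + Z w)) / F w := by
    have h := intervalIntegral.integral_comp_mul_deriv (a := 0) (b := L) (f := θ)
      (f' := fun x => F (θ x)) (g := fun w => Real.exp (2 * (α + Z w)) / F w)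
      (fun x _ => hθd x) (by fun_prop)
      (Continuous.div (by fun_prop) hFc fun w => (hFp w).ne')
    rw [ht0, htL] at h
    rw [← h]
    apply intervalIntegral.integral_congr
    intro x hx
    rw [uIcc_of_le hLp.le] at hx
    have := (hFp (θ x)).ne'
    simp only [Function.comp, hmid x hx.1 hx.2, ← Real.exp_nat_mul]
    field_simp
    push_cast; ring_nf
  have cv2 : ∫ x in (0 : ℝ)..L, A x = ∫ w in (-1 : ℝ)..1, Real.exp (2 * (α + Z w)) := by
    have h := intervalIntegral.integral_comp_mul_deriv (a := 0) (b := L) (f := θ)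
      (f' := fun x => F (θ x)) (g := fun w => Real.exp (2 * (α + Z w)))
      (fun x _ => hθd x) (by fun_prop) (by fun_prop)
    rw [ht0, htL] at h
    rw [← h]
    apply intervalIntegral.integral_congr
    intro x hx
    rw [uIcc_of_le hLp.le] at hx
    simp only [hA, Function.comp, hmid x hx.1 hx.2, ← Real.exp_nat_mul]
    push_cast; ring
  have bd : ∫ x in (0 : ℝ)..L, v x ^ 2 ≤ 2 / q * (∫ x in (0 : ℝ)..L, A x) + ∫ x in (0 : ℝ)..L, B x := by
    rw [← intervalIntegral.integral_const_mul, ← intervalIntegral.integral_add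
      ((by fun_prop : Continuous fun x => 2 / q * A x).intervalIntegrable _ _) (hBc.intervalIntegrable _ _)]
    apply intervalIntegral.integral_mono_on hLp.le
      ((hvc.pow 2).intervalIntegrable _ _)
      ((by fun_prop : Continuous fun x => 2 / q * A x + B x).intervalIntegrable _ _)
    intro x _
    simp only [hA, hB, hv1, Pi.pow_apply]
    have := mul_le_mul_of_nonneg_right (hFs (θ x)) (sq_nonneg (v x))
    linarith
  have bdp : ∫ x in (0 : ℝ)..L, v x ^ (q + 2) ≤ (q + 2) / q * (∫ x in (0 : ℝ)..L, A x) := by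
    rw [← intervalIntegral.integral_const_mul]
    apply intervalIntegral.integral_mono_on hLp.le
    · exact (hvc.rpow_const fun x => Or.inl (hvp x).ne').intervalIntegrable _ _
    · exact (continuous_const.mul hAc).intervalIntegrable _ _
    intro x hx
    rw [Real.rpow_add (hvp x), hvq x hx.1 hx.2, Real.rpow_two]
    have := mul_le_mul_of_nonneg_right (hFs (θ x)) (sq_nonneg (v x))
    simp only [hA]
    have e : (q + 2) / q = 1 + 2 / q := by field_simp
    rw [e]
    linarith
  have hαp := Real.exp_pos (2 * α)
  refine ⟨v, v1, hLp, hvd, hv1c, hvp, ?_, ?_, ?_, T1.1, T2.1, ?_, ?_, ?_⟩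
  · intro x hx
    refine (hvd x).congr_of_eventuallyEq ?_ |>.congr_deriv ?_
    · filter_upwards [Iio_mem_nhds hx] with y hy
      simp only [hv1, klo y (le_of_lt hy)]; ring
    · rw [klo x hx.le]; ring
  · intro x hx
    refine (hvd x).neg.congr_of_eventuallyEq ?_ |>.congr_deriv ?_
    · filter_upwards [Ioi_mem_nhds hx] with y hy
      simp only [hv1, khi y (le_of_lt hy)]; simp
    · rw [khi x hx.le]; ring
  · intro x hx0 hxL
    refine ((hθd x).neg.mul (hvd x)).congr_of_eventuallyEq ?_ |>.congr_deriv ?_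
    · filter_upwards [Ioo_mem_nhds hx0 hxL] with y hy
      simp only [hv1, kmid y hy.1.le hy.2.le]; simp
    · rw [Real.rpow_add (hvp x), Real.rpow_one, hvq x hx0.le hxL.le, kmid x hx0.le hxL.le]
      simp only [Pi.neg_apply]
      ring
  · rw [T1.2, cv1]
  · rw [T1.2, ← cv2]
    linarith
  · rw [T2.2]
    change 0 < 1 / 2 * (Real.exp (2 * α) + ∫ x in (0 : ℝ)..L, B x) - _
    set IA := ∫ x in (0 : ℝ)..L, A x
    set IB := ∫ x in (0 : ℝ)..L, B x
    have h1 : 1 / (q + 2) * (∫ x in (0 : ℝ)..L, v x ^ (q + 2)) ≤ 1 / q * IA := by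
      have := mul_le_mul_of_nonneg_left bdp (by positivity : 0 ≤ 1 / (q + 2))
      refine this.trans (le_of_eq ?_)
      field_simp
    have h2 : IA = 2 * (IB + Real.exp (2 * α)) := by linarith
    have h3 : 1 / q < 1 / 4 := one_div_lt_one_div_of_lt (by norm_num) hq
    have h4 : 1 / q * IA < 1 / 4 * IA := mul_lt_mul_of_pos_right h3 (by linarith)
    linarith


theorem low_bound (q ε : ℝ) (hq : 4 < q) (hε : 0 < ε) (F : ℝ → ℝ) (hFc : Continuous F)
    (hFp : ∀ w, 0 < F w) (hF : ∀ w, -1 ≤ w → w ≤ 1 → F w ≤ q / 2 * (1 - w ^ 2) + ε) :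
    -(Real.log ε / q) ≤ ∫ w in (-1 : ℝ)..1, 1 / F w := by
  have hp : ∀ w : ℝ, w ≤ 1 → 0 < q * (1 - w) + ε := fun w hw => by nlinarith
  have hcont : ContinuousOn (fun w : ℝ => 1 / (q * (1 - w) + ε)) (uIcc (-1) 1) := by
    apply ContinuousOn.div (by fun_prop) (by fun_prop)
    intro w hw
    rw [uIcc_of_le (by norm_num)] at hw
    exact (hp w hw.2).ne'
  have h := intervalIntegral.integral_eq_sub_of_hasDerivAt (a := -1) (b := 1)
    (f := fun w => -(Real.log (q * (1 - w) + ε) / q)) (f' := fun w => 1 / (q * (1 - w) + ε)) (by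
      intro w hw
      rw [uIcc_of_le (by norm_num)] at hw
      have h1 : HasDerivAt (fun w : ℝ => q * (1 - w) + ε) (q * (-1)) w :=
        (((hasDerivAt_id w).const_sub 1).const_mul q).add_const ε
      have := ((h1.log (hp w hw.2).ne').div_const q).neg
      refine this.congr_deriv ?_
      have := (hp w hw.2).ne'
      field_simp) hcont.intervalIntegrable
  have h2 : ∫ w in (-1 : ℝ)..1, 1 / (q * (1 - w) + ε) ≤ ∫ w in (-1 : ℝ)..1, 1 / F w := by
    apply intervalIntegral.integral_mono_on (by norm_num) hcont.intervalIntegrable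
    · exact (continuous_const.div hFc fun w => (hFp w).ne').intervalIntegrable _ _
    · intro w hw
      apply one_div_le_one_div_of_le (hFp w)
      refine (hF w hw.1 hw.2).trans ?_
      nlinarith [mul_nonneg (by linarith : 0 ≤ q) (sq_nonneg (1 - w))]
  rw [h] at h2
  refine le_trans ?_ h2
  have h3 : 0 ≤ Real.log (q * (1 - -1) + ε) := Real.log_nonneg (by linarith)
  have h4 : 0 ≤ Real.log (q * (1 - -1) + ε) / q := div_nonneg h3 (by linarith)
  simp only [sub_self, mul_zero, zero_add]
  linarith

theorem stepD (q μ ℓ : ℝ) (hq : 4 < q) (hμ : 0 < μ) (hℓ : 0 < ℓ) :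
    ∃ (L : ℝ) (v v1 : ℝ → ℝ), 0 < L ∧ (∀ x, HasDerivAt v (v1 x) x) ∧ Continuous v1 ∧ (∀ x, 0 < v x) ∧
      (∀ x, x < 0 → HasDerivAt v1 (v x) x) ∧ (∀ x, L < x → HasDerivAt v1 (v x) x) ∧
      (∀ x, 0 < x → x < L → HasDerivAt v1 (v x - v x ^ (q + 1)) x) ∧
      Integrable (fun x => v x ^ 2) ∧ Integrable (fun x => v1 x ^ 2) ∧
      (L / ℓ) ^ (4 / q - 1) * ∫ x, v x ^ 2 = μ ∧
      0 < (1 / 2) * (∫ x, v1 x ^ 2) - (1 / (q + 2)) * ∫ x in (0 : ℝ)..L, v x ^ (q + 2) := by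
  obtain ⟨Z, F, hZc, hFc, hFp, hZ0, hF1, hF2, hZl, hZr, hZd⟩ := stepA q hq
  have hZc' : ∀ α, Continuous (Z α) := fun α => hZc.comp (Continuous.prodMk_right α)
  have hFc' : ∀ α, Continuous (F α) := fun α => hFc.comp (Continuous.prodMk_right α)
  set Lf : ℝ → ℝ := fun α => ∫ w in (-1 : ℝ)..1, 1 / F α w with hLf
  set N : ℝ → ℝ := fun α => ∫ w in (-1 : ℝ)..1, Real.exp (2 * (α + Z α w)) / F α w with hN
  have main := fun α => stepC q α hq (Z α) (F α) (hZc' α) (hFc' α) (hFp α) (hZ0 α) (hF1 α) (hF2 α)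
    (hZl α) (hZr α) (hZd α) (Lf α) rfl
  have hLfc : Continuous Lf := by
    apply intervalIntegral.continuous_parametric_intervalIntegral_of_continuous'
    exact Continuous.div continuous_const hFc fun x => (hFp x.1 x.2).ne'
  have hNc : Continuous N := by
    apply intervalIntegral.continuous_parametric_intervalIntegral_of_continuous'
    refine Continuous.div ?_ hFc fun x => (hFp x.1 x.2).ne'
    exact Real.continuous_exp.comp (continuous_const.mul (continuous_fst.add hZc))
  have hLp : ∀ α, 0 < Lf α := fun α => by
    obtain ⟨v, v1, h, -⟩ := main α
    exact h
  have hNp : ∀ α, 0 ≤ N α := fun α =>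
    intervalIntegral.integral_nonneg (by norm_num) fun w _ =>
      div_nonneg (Real.exp_pos _).le (hFp α w).le
  have hNb : ∀ α, Real.exp (2 * α) + N α ≤
      (2 / q + 1 / 2) * ∫ w in (-1 : ℝ)..1, Real.exp (2 * (α + Z α w)) := fun α => by
    obtain ⟨v, v1, -, -, -, -, -, -, -, -, -, h1, h2, -⟩ := main α
    rw [h1] at h2
    exact h2
  set Φ : ℝ → ℝ := fun α => (Lf α / ℓ) ^ (4 / q - 1) * (Real.exp (2 * α) + N α) with hΦ
  have hΦc : Continuous Φ := by
    refine Continuous.mul ?_ ((by fun_prop : Continuous fun α : ℝ => Real.exp (2 * α)).add hNc)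
    exact (hLfc.div_const ℓ).rpow_const fun x => Or.inl (div_pos (hLp x) hℓ).ne'
  have h4q : 4 / q < 1 := by rw [div_lt_one (by linarith)]; exact hq
  have hneg : 4 / q - 1 < 0 := by linarith
  have hE : ∀ α w, Real.exp (q * (α + Z α w)) = F α w + (1 - kap w ^ 2) := fun α w => by
    linarith [hF1 α w]
  have lo : ∃ α, Φ α ≤ μ := by
    have ht := (tendsto_rpow_neg_atTop (by linarith : 0 < 1 - 4 / q)).mul_const (q + 4)
    rw [zero_mul] at ht
    obtain ⟨x, hx1, hx2⟩ := ((ht.eventually (gt_mem_nhds hμ)).and (eventually_ge_atTop 1)).exists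
    refine ⟨-(ℓ * x), ?_⟩
    set α := -(ℓ * x) with hα
    have hα0 : α ≤ 0 := by
      have : 0 ≤ ℓ * x := by positivity
      linarith
    have hL1 : -α ≤ Lf α := by
      have := low_bound q (Real.exp (q * α)) hq (Real.exp_pos _) (F α) (hFc' α) (hFp α) (by
        intro w h1 h2
        rw [hF2, kap_mid h1 h2]
        have : Real.exp (q * α - 2 * Z α w) ≤ Real.exp (q * α) :=
          Real.exp_le_exp.2 (by linarith [hZ0 α w])
        linarith)
      rw [Real.log_exp, mul_div_cancel_left₀ _ (by linarith : q ≠ 0)] at this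
      exact this
    have hL2 : x ≤ Lf α / ℓ := by
      rw [le_div_iff₀ hℓ]; linarith
    have hm : Real.exp (2 * α) + N α ≤ q + 4 := by
      refine (hNb α).trans ?_
      have hb : ∫ w in (-1 : ℝ)..1, Real.exp (2 * (α + Z α w)) ≤ ∫ w in (-1 : ℝ)..1, (q / 2 + 2) := by
        have := hZc' α
        apply intervalIntegral.integral_mono_on (by norm_num)
          ((by fun_prop : Continuous fun w => Real.exp (2 * (α + Z α w))).intervalIntegrable _ _)
          (continuous_const.intervalIntegrable _ _)
        intro w _
        rcases le_total 0 (α + Z α w) with h | h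
        · have h1 : Real.exp (2 * (α + Z α w)) ≤ Real.exp (q * (α + Z α w)) :=
            Real.exp_le_exp.2 (by nlinarith)
          have h2 := hE α w
          rw [hF2] at h2
          have h3 : Real.exp (q * α - 2 * Z α w) ≤ 1 :=
            Real.exp_le_one_iff.2 (by nlinarith [hZ0 α w])
          nlinarith [sq_nonneg (kap w)]
        · have : Real.exp (2 * (α + Z α w)) ≤ 1 := Real.exp_le_one_iff.2 (by linarith)
          linarith
      rw [intervalIntegral.integral_const, smul_eq_mul] at hb
      have h5 : 2 / q + 1 / 2 ≤ 1 := by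
        have : 2 / q = (4 / q) / 2 := by ring
        linarith
      have h6 : 0 ≤ 2 / q + 1 / 2 := by positivity
      have h7 := mul_le_mul_of_nonneg_left hb h6
      nlinarith
    have h8 : (Lf α / ℓ) ^ (4 / q - 1) ≤ x ^ (4 / q - 1) :=
      Real.rpow_le_rpow_of_nonpos (by linarith) hL2 hneg.le
    have h9 : Φ α ≤ x ^ (4 / q - 1) * (q + 4) :=
      mul_le_mul h8 hm (by have := hNp α; positivity) (by positivity)
    rw [show -(1 - 4 / q) = 4 / q - 1 by ring] at hx1
    exact h9.trans hx1.le
  have hi : ∃ α, μ ≤ Φ α := by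
    set c := (4 / ℓ) ^ (4 / q - 1) with hc
    have hcp : 0 < c := by positivity
    refine ⟨μ / c, ?_⟩
    set α := μ / c with hα
    have hα0 : 0 < α := by positivity
    have hF : ∀ w, 1 / 2 ≤ F α w := fun w => by
      have h1 := hE α w
      have h2 := hF2 α w
      have h3 : 1 ≤ Real.exp (q * (α + Z α w)) := Real.one_le_exp (by
        have := hZ0 α w
        positivity)
      have h4 := Real.exp_pos (q * α - 2 * Z α w)
      nlinarith [kap_sq w]
    have hL4 : Lf α ≤ 4 := by
      have : Lf α ≤ ∫ w in (-1 : ℝ)..1, (2 : ℝ) := by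
        apply intervalIntegral.integral_mono_on (by norm_num)
          ((continuous_const.div (hFc' α) fun w => (hFp α w).ne').intervalIntegrable _ _)
          (continuous_const.intervalIntegrable _ _)
        intro w _
        change 1 / F α w ≤ 2
        rw [div_le_iff₀ (hFp α w)]
        linarith [hF w]
      refine this.trans ?_
      rw [intervalIntegral.integral_const]; norm_num
    have h8 : c ≤ (Lf α / ℓ) ^ (4 / q - 1) :=
      Real.rpow_le_rpow_of_nonpos (div_pos (hLp α) hℓ)
        (div_le_div_of_nonneg_right hL4 hℓ.le) hneg.le
    have h9 : α ≤ Real.exp (2 * α) + N α := by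
      have := Real.add_one_le_exp (2 * α)
      linarith [hNp α]
    have h10 : c * α ≤ Φ α := mul_le_mul h8 h9 hα0.le (hcp.le.trans h8)
    have : c * α = μ := by rw [hα]; field_simp
    linarith
  obtain ⟨α, hα⟩ := mem_range_of_exists_le_of_exists_ge hΦc lo hi
  obtain ⟨v, v1, h1, h2, h3, h4, h5, h6, h7, h8, h9, h10, -, h12⟩ := main α
  refine ⟨Lf α, v, v1, h1, h2, h3, h4, h5, h6, h7, h8, h9, ?_, h12⟩
  rw [h10]
  exact hα

theorem stmt_0 (p μ ℓ : ℝ) (hp : 6 < p) (hμ : 0 < μ) (hℓ : 0 < ℓ) :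
    ∃ (lam : ℝ) (u : ℝ → ℝ), 0 < lam ∧
      ContDiff ℝ 1 u ∧
      (∀ x : ℝ, x ≠ 0 → x ≠ ℓ → DifferentiableAt ℝ (deriv u) x) ∧
      (∀ x : ℝ, 0 < u x) ∧
      Integrable (fun x : ℝ => (u x) ^ 2) ∧
      Integrable (fun x : ℝ => (deriv u x) ^ 2) ∧
      (∫ x : ℝ, (u x) ^ 2) = μ ∧
      (∀ x : ℝ, x ≠ 0 → x ≠ ℓ →
        -(deriv (deriv u) x) + lam * u x
          = Set.indicator (Set.Icc 0 ℓ) (fun _ => (1 : ℝ)) x * (u x) ^ (p - 1)) ∧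
      0 < (1 / 2) * (∫ x : ℝ, (deriv u x) ^ 2)
            - (1 / p) * (∫ x in (0 : ℝ)..ℓ, (u x) ^ p) := by
  obtain ⟨q, rfl⟩ : ∃ q, p = q + 2 := ⟨p - 2, by ring⟩
  have hq : 4 < q := by linarith
  obtain ⟨L, v, v1, hL, hvd, hv1c, hvp, hlo, hhi, hmid, hi1, hi2, hmass, hen⟩ :=
    stepD q μ ℓ hq hμ hℓ
  set k := L / ℓ with hk
  have hkp : 0 < k := div_pos hL hℓ
  have hkℓ : k * ℓ = L := by rw [hk]; field_simp
  set c := k ^ (2 / q) with hc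
  have hcp : 0 < c := Real.rpow_pos_of_pos hkp _
  have hcq : c ^ q = k ^ 2 := by
    rw [hc, ← Real.rpow_mul hkp.le, div_mul_cancel₀ _ (by linarith : q ≠ 0), Real.rpow_two]
  have hc2 : k ^ (4 / q - 1) = c ^ 2 * k⁻¹ := by
    rw [sub_eq_add_neg, Real.rpow_add hkp, Real.rpow_neg_one, hc, ← Real.rpow_mul_natCast hkp.le]
    congr 2; push_cast; ring
  have hlin : ∀ x, HasDerivAt (fun x : ℝ => k * x) k x := fun x => by
    simpa using (hasDerivAt_id x).const_mul k
  set u : ℝ → ℝ := fun x => c * v (k * x) with hu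
  have hud : ∀ x, HasDerivAt u (c * k * v1 (k * x)) x := fun x => by
    have := ((hvd (k * x)).comp x (hlin x)).const_mul c
    exact this.congr_deriv (by ring)
  have hdu : deriv u = fun x => c * k * v1 (k * x) := funext fun x => (hud x).deriv
  have hsec : ∀ x d, HasDerivAt v1 d (k * x) → HasDerivAt (deriv u) (c * k ^ 2 * d) x := by
    intro x d h
    rw [hdu]
    have := (h.comp x (hlin x)).const_mul (c * k)
    exact this.congr_deriv (by ring)
  have hup : ∀ x, 0 < u x := fun x => mul_pos hcp (hvp _)
  have hneg : ∀ x, x < 0 → HasDerivAt (deriv u) (k ^ 2 * u x) x := fun x hx =>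
    (hsec x _ (hlo _ (mul_neg_of_pos_of_neg hkp hx))).congr_deriv (by simp only [hu]; ring)
  have hbig : ∀ x, ℓ < x → HasDerivAt (deriv u) (k ^ 2 * u x) x := fun x hx =>
    (hsec x _ (hhi _ (by rw [← hkℓ]; exact mul_lt_mul_of_pos_left hx hkp))).congr_deriv
      (by simp only [hu]; ring)
  have hin : ∀ x, 0 < x → x < ℓ → HasDerivAt (deriv u) (k ^ 2 * u x - u x ^ (q + 1)) x := by
    intro x h0 h1
    refine (hsec x _ (hmid _ (mul_pos hkp h0)
      (by rw [← hkℓ]; exact mul_lt_mul_of_pos_left h1 hkp))).congr_deriv ?_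
    simp only [hu]
    rw [Real.mul_rpow hcp.le (hvp _).le, Real.rpow_add hcp, Real.rpow_one, hcq]
    ring
  have hcase : ∀ x, x ≠ 0 → x ≠ ℓ → x < 0 ∨ ℓ < x ∨ (0 < x ∧ x < ℓ) := by
    intro x h0 h1
    rcases lt_or_gt_of_ne h0 with h | h
    · exact Or.inl h
    rcases lt_or_gt_of_ne h1 with h' | h'
    · exact Or.inr (Or.inr ⟨h, h'⟩)
    · exact Or.inr (Or.inl h')
  have hu2 : (fun x => u x ^ 2) = fun x => c ^ 2 * v (k * x) ^ 2 := by
    funext x; simp only [hu]; ring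
  have hdu2 : (fun x => deriv u x ^ 2) = fun x => c ^ 2 * k ^ 2 * v1 (k * x) ^ 2 := by
    funext x; simp only [hdu]; ring
  refine ⟨k ^ 2, u, by positivity, ?_, ?_, hup, ?_, ?_, ?_, ?_, ?_⟩
  · rw [contDiff_one_iff_deriv]
    refine ⟨fun x => (hud x).differentiableAt, ?_⟩
    rw [hdu]; fun_prop
  · intro x h0 h1
    rcases hcase x h0 h1 with h | h | ⟨h, h'⟩
    · exact (hneg x h).differentiableAt
    · exact (hbig x h).differentiableAt
    · exact (hin x h h').differentiableAt
  · rw [hu2]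
    exact ((integrable_comp_mul_left_iff (fun x => v x ^ 2) hkp.ne').2 hi1).const_mul _
  · rw [hdu2]
    exact ((integrable_comp_mul_left_iff (fun x => v1 x ^ 2) hkp.ne').2 hi2).const_mul _
  · rw [hu2, integral_const_mul, Measure.integral_comp_mul_left (fun x => v x ^ 2) k,
      abs_of_pos (inv_pos.2 hkp), smul_eq_mul, ← mul_assoc, ← hc2]
    exact hmass
  · intro x h0 h1
    rcases hcase x h0 h1 with h | h | ⟨h, h'⟩
    · rw [(hneg x h).deriv, indicator_of_notMem (fun hx => absurd hx.1 (not_le.2 h))]; ring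
    · rw [(hbig x h).deriv, indicator_of_notMem (fun hx => absurd hx.2 (not_le.2 h))]; ring
    · rw [(hin x h h').deriv, indicator_of_mem (show x ∈ Icc 0 ℓ from ⟨h.le, h'.le⟩),
        show q + 2 - 1 = q + 1 by ring]
      ring
  · have e1 : ∫ x, deriv u x ^ 2 = c ^ 2 * k * ∫ x, v1 x ^ 2 := by
      rw [hdu2, integral_const_mul, Measure.integral_comp_mul_left (fun x => v1 x ^ 2) k,
        abs_of_pos (inv_pos.2 hkp), smul_eq_mul]
      field_simp
    have e2 : ∫ x in (0 : ℝ)..ℓ, u x ^ (q + 2) = c ^ 2 * k * ∫ x in (0 : ℝ)..L, v x ^ (q + 2) := by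
      have : (fun x => u x ^ (q + 2)) = fun x => c ^ 2 * k ^ 2 * v (k * x) ^ (q + 2) := by
        funext x
        simp only [hu]
        rw [Real.mul_rpow hcp.le (hvp _).le, Real.rpow_add hcp, Real.rpow_two, hcq]
        ring
      rw [this, intervalIntegral.integral_const_mul,
        intervalIntegral.integral_comp_mul_left (fun x => v x ^ (q + 2)) hkp.ne', mul_zero, hkℓ,
        smul_eq_mul]
      field_simp
    rw [e1, e2]
    have := mul_pos (by positivity : 0 < c ^ 2 * k) hen
    linarith
end

section
/- Let p > 6, ℓ > 0 and λ > 0, and let u : ℝ → ℝ be continuously differentiable on ℝ, twice differentiable at every point of ℝ ∖ {0, ℓ}, with u(x) > 0 for all x, u and u' square-integrable on ℝ, and −u''(x) + λ·u(x) = χ_{[0,ℓ]}(x)·u(x)^{p−1} for every x ∈ ℝ ∖ {0, ℓ}. Then: (a) every local maximum point of u lies in the compact core [0, ℓ]; and (b) u(x) = u(ℓ)·e^{−√λ·(x−ℓ)} for every x ≥ ℓ, and u(x) = u(0)·e^{√λ·x} for every x ≤ 0. -/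
open MeasureTheory Set Filter

theorem aux_const (f : ℝ → ℝ) (a : ℝ) (hc : Continuous f)
    (hd : ∀ x, a < x → HasDerivAt f 0 x) : ∀ x, a ≤ x → f x = f a := by
  intro x hx
  rcases hx.eq_or_lt with h | h
  · rw [h]
  · obtain ⟨c, hc1, hc2⟩ := exists_hasDerivAt_eq_slope f (fun _ => 0) h hc.continuousOn
      (fun y hy => hd y hy.1)
    have : x - a ≠ 0 := by linarith
    field_simp at hc2
    linarith

theorem aux_half (v : ℝ → ℝ) (a k : ℝ) (hk : 0 < k) (hv : ContDiff ℝ 1 v)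
    (h2 : ∀ x, a < x → HasDerivAt (deriv v) (k ^ 2 * v x) x)
    (hL : Integrable (fun x : ℝ => (v x) ^ 2))
    (hL' : Integrable (fun x : ℝ => (deriv v x) ^ 2)) :
    (∀ x, a ≤ x → deriv v x = -k * v x) ∧
    (∀ x, a ≤ x → v x = v a * Real.exp (-k * (x - a))) := by
  have hvc : Continuous v := hv.continuous
  have hdc : Continuous (deriv v) := hv.continuous_deriv le_rfl
  have hvd : ∀ x, HasDerivAt v (deriv v x) x := fun x =>
    ((hv.differentiable one_ne_zero) x).hasDerivAt
  have hexp : ∀ c x : ℝ, HasDerivAt (fun y => Real.exp (c * y)) (c * Real.exp (c * x)) x := by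
    intro c x
    have := ((hasDerivAt_id x).const_mul c).exp
    simp only [id, mul_one] at this
    rw [mul_comm]; exact this
  have hw := aux_const (fun x => (deriv v x + k * v x) * Real.exp (-k * x)) a (by fun_prop) (by
    intro x hx
    have := ((h2 x hx).add ((hvd x).const_mul k)).mul (hexp (-k) x)
    refine this.congr_deriv ?_
    simp only [Pi.add_apply]
    ring)
  have hw0 : deriv v a + k * v a = 0 := by
    by_contra hne
    set C := deriv v a + k * v a with hC
    have hint : Integrable (fun x => 2 * (deriv v x) ^ 2 + 2 * k ^ 2 * (v x) ^ 2) :=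
      (hL'.const_mul 2).add (hL.const_mul (2 * k ^ 2))
    have hc : IntegrableOn (fun _ : ℝ => C ^ 2) (Ioi a) := by
      refine Integrable.mono' hint.integrableOn (by fun_prop) ?_
      refine (ae_restrict_iff' measurableSet_Ioi).2 (Eventually.of_forall ?_)
      intro x hx
      have hx' : a < x := hx
      have h := hw x hx'.le
      have h3 : C ^ 2 ≤ (deriv v x + k * v x) ^ 2 := by
        have e1 : 0 < Real.exp (-k * x) := Real.exp_pos _
        have e2 : Real.exp (-k * x) ≤ Real.exp (-k * a) := Real.exp_le_exp.2 (by nlinarith)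
        have h4 : (deriv v x + k * v x) ^ 2 * Real.exp (-k * x) ^ 2
            = C ^ 2 * Real.exp (-k * a) ^ 2 := by
          rw [← mul_pow, h, mul_pow]
        have h5 : C ^ 2 * Real.exp (-k * x) ^ 2 ≤ C ^ 2 * Real.exp (-k * a) ^ 2 := by gcongr
        rw [← h4] at h5
        exact le_of_mul_le_mul_right h5 (by positivity)
      rw [Real.norm_of_nonneg (sq_nonneg C)]
      nlinarith [sq_nonneg (deriv v x - k * v x)]
    rw [integrableOn_const_iff] at hc
    simp [hne] at hc
  have hd : ∀ x, a ≤ x → deriv v x = -k * v x := by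
    intro x hx
    have h := hw x hx
    simp only [hw0, zero_mul] at h
    have := (mul_eq_zero.1 h).resolve_right (Real.exp_pos _).ne'
    linarith
  refine ⟨hd, fun x hx => ?_⟩
  have h := aux_const (fun x => v x * Real.exp (k * x)) a (by fun_prop) (by
    intro x hx
    refine ((hvd x).mul (hexp k x)).congr_deriv ?_
    rw [hd x hx.le]; ring) x hx
  have e : Real.exp (-k * (x - a)) = Real.exp (k * a) / Real.exp (k * x) := by
    rw [← Real.exp_sub]; ring_nf
  rw [e, ← mul_div_assoc, ← h]
  field_simp

/-- Proposition 1.2 of the paper, on the real line with compact core `[0, ℓ]`: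
any positive bound state with positive Lagrange multiplier has all its local maximum
points in `[0, ℓ]`, and is an explicit decaying exponential on the two half-lines. -/
theorem stmt_1 (p ℓ lam : ℝ) (hp : 6 < p) (hℓ : 0 < ℓ) (hlam : 0 < lam)
    (u : ℝ → ℝ)
    (hu1 : ContDiff ℝ 1 u)
    (hu2 : ∀ x : ℝ, x ≠ 0 → x ≠ ℓ → DifferentiableAt ℝ (deriv u) x)
    (hpos : ∀ x : ℝ, 0 < u x)
    (hL2 : Integrable (fun x : ℝ => (u x) ^ 2))
    (hL2' : Integrable (fun x : ℝ => (deriv u x) ^ 2))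
    (heq : ∀ x : ℝ, x ≠ 0 → x ≠ ℓ →
      -(deriv (deriv u) x) + lam * u x
        = Set.indicator (Set.Icc 0 ℓ) (fun _ => (1 : ℝ)) x * (u x) ^ (p - 1)) :
    (∀ x₀ : ℝ, IsLocalMax u x₀ → x₀ ∈ Set.Icc 0 ℓ) ∧
    (∀ x : ℝ, ℓ ≤ x → u x = u ℓ * Real.exp (-(Real.sqrt lam) * (x - ℓ))) ∧
    (∀ x : ℝ, x ≤ 0 → u x = u 0 * Real.exp (Real.sqrt lam * x)) := by
  have hk : 0 < Real.sqrt lam := Real.sqrt_pos.2 hlam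
  have hk2 : Real.sqrt lam ^ 2 = lam := Real.sq_sqrt hlam.le
  have hdd : ∀ x, x ∉ Set.Icc 0 ℓ → HasDerivAt (deriv u) (Real.sqrt lam ^ 2 * u x) x := by
    intro x hx
    have h0 : x ≠ 0 := by rintro rfl; exact hx ⟨le_rfl, hℓ.le⟩
    have h1 : x ≠ ℓ := by rintro rfl; exact hx ⟨hℓ.le, le_rfl⟩
    have h := heq x h0 h1
    rw [Set.indicator_of_notMem hx] at h
    refine (hu2 x h0 h1).hasDerivAt.congr_deriv ?_
    rw [hk2]; linarith
  have hR := aux_half u ℓ _ hk hu1 (fun x hx => hdd x (fun h => absurd h.2 (not_le.2 hx))) hL2 hL2'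
  have hder : deriv (fun x => u (-x)) = fun x => -deriv u (-x) := by
    funext x; exact deriv_comp_neg u x
  have hLf := aux_half (fun x => u (-x)) 0 _ hk (hu1.comp contDiff_neg) (by
      intro x hx
      rw [hder]
      have h := hdd (-x) (fun h => by linarith [h.1])
      have h' := (h.comp x (hasDerivAt_neg x)).neg
      refine h'.congr_deriv ?_
      ring) hL2.comp_neg (by
      rw [hder]
      simpa using hL2'.comp_neg)
  refine ⟨fun x₀ hx => ?_, hR.2, fun x hx => ?_⟩
  · have h0 := hx.deriv_eq_zero
    have hp0 := mul_pos hk (hpos x₀)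
    by_contra hn
    rcases lt_or_ge x₀ 0 with h | h
    · have := hLf.1 (-x₀) (by linarith)
      rw [hder] at this
      simp only [neg_neg] at this
      linarith
    · have := hR.1 x₀ (le_of_lt (not_le.1 fun h' => hn ⟨h, h'⟩))
      linarith
  · have := hLf.2 (-x) (by linarith)
    simpa using this
end

section
/- For every λ < 0 there exist three infinitely differentiable functions ψ₀, ψ₁, ψ₂ : ℝ → ℝ, each compactly supported in (0, +∞), with pairwise disjoint supports and ∫_ℝ ψ_j² dx = 1 for j = 0, 1, 2, such that their span Y is a 3-dimensional real vector space and, for every w ∈ Y, ∫_ℝ |w'|² dx + λ·∫_ℝ |w|² dx ≤ (λ/2)·( ∫_ℝ |w'|² dx + ∫_ℝ |w|² dx ). -/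
open MeasureTheory Set Filter

lemma aux_bump : ∃ φ : ℝ → ℝ, ContDiff ℝ (⊤ : ℕ∞) φ ∧ φ 0 = 1 ∧
    (∀ y, φ y ≠ 0 → |y| ≤ 2) ∧ (∀ y, deriv φ y ≠ 0 → |y| ≤ 2) ∧ HasCompactSupport φ := by
  let f : ContDiffBump (0 : ℝ) := ⟨1, 2, by norm_num, by norm_num⟩
  have ht : tsupport f = Metric.closedBall 0 2 := f.tsupport_eq
  refine ⟨f, f.contDiff, ?_, ?_, ?_, f.hasCompactSupport⟩
  · exact f.one_of_mem_closedBall (by simp [f])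
  · intro y hy
    have : y ∈ tsupport f := subset_tsupport _ hy
    rw [ht] at this
    simpa using this
  · intro y hy
    have : y ∈ tsupport f := support_deriv_subset hy
    rw [ht] at this
    simpa using this

lemma aux_int (g : ℝ → ℝ) (s c : ℝ) (hs : 0 < s) :
    ∫ x : ℝ, (g (s * x - c)) ^ 2 = s⁻¹ * ∫ x : ℝ, (g x) ^ 2 := by
  have h := Measure.integral_comp_mul_left (fun y => (g (y - c)) ^ 2) s
  rw [h, abs_of_pos (inv_pos.2 hs), smul_eq_mul]
  congr 1
  exact integral_sub_right_eq_self (fun y => (g y) ^ 2) c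

lemma aux_sep (i j : Fin 3) (y : ℝ) (hi : |y - (5 * (i : ℝ) + 3)| ≤ 2)
    (hj : |y - (5 * (j : ℝ) + 3)| ≤ 2) : i = j := by
  rw [abs_le] at hi hj
  have h1 : ((i : ℕ) : ℝ) < (j : ℕ) + 1 := by linarith
  have h2 : ((j : ℕ) : ℝ) < (i : ℕ) + 1 := by linarith
  norm_cast at h1 h2
  ext
  omega

lemma aux_sq (u : Fin 3 → ℝ → ℝ) (hu : ∀ i j x, u i x ≠ 0 → u j x ≠ 0 → i = j)
    (hi : ∀ j, Integrable (fun x => (u j x) ^ 2)) (c : Fin 3 → ℝ) :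
    ∫ x : ℝ, (∑ j, c j * u j x) ^ 2 = ∑ j, c j ^ 2 * ∫ x : ℝ, (u j x) ^ 2 := by
  have : ∀ x, (∑ j, c j * u j x) ^ 2 = ∑ j, c j ^ 2 * (u j x) ^ 2 := by
    intro x
    have h : ∀ i j, i ≠ j → u i x * u j x = 0 := by
      intro i j hij
      by_contra hne
      exact hij (hu i j x (left_ne_zero_of_mul hne) (right_ne_zero_of_mul hne))
    have h01 := h 0 1 (by decide)
    have h02 := h 0 2 (by decide)
    have h12 := h 1 2 (by decide)
    simp only [Fin.sum_univ_three]
    linear_combination 2 * c 0 * c 1 * h01 + 2 * c 0 * c 2 * h02 + 2 * c 1 * c 2 * h12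
  simp_rw [this]
  rw [integral_finsetSum _ (fun j _ => (hi j).const_mul _)]
  simp_rw [integral_const_mul]

theorem stmt_5 :
    ∀ lam : ℝ, lam < 0 →
      ∃ ψ : Fin 3 → (ℝ → ℝ),
        (∀ j, ContDiff ℝ (⊤ : ℕ∞) (ψ j)) ∧
        (∀ j, HasCompactSupport (ψ j)) ∧
        (∀ j, tsupport (ψ j) ⊆ Set.Ioi (0 : ℝ)) ∧
        (Pairwise fun i j => Disjoint (Function.support (ψ i)) (Function.support (ψ j))) ∧
        (∀ j, (∫ x : ℝ, (ψ j x) ^ 2) = 1) ∧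
        Module.finrank ℝ (Submodule.span ℝ (Set.range ψ)) = 3 ∧
        (∀ w ∈ Submodule.span ℝ (Set.range ψ),
          (∫ x : ℝ, (deriv w x) ^ 2) + lam * (∫ x : ℝ, (w x) ^ 2)
            ≤ (lam / 2) * ((∫ x : ℝ, (deriv w x) ^ 2) + (∫ x : ℝ, (w x) ^ 2))) := by
  intro lam hlam
  obtain ⟨φ, hφ, h0, hs1, hs2, hcs⟩ := aux_bump
  have hφc : Continuous φ := hφ.continuous
  have hφd : Continuous (deriv φ) := hφ.continuous_deriv (by norm_cast)
  have hφdiff : Differentiable ℝ φ := hφ.differentiable (by simp)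
  obtain ⟨A, hA⟩ : ∃ A, A = ∫ x : ℝ, (φ x) ^ 2 := ⟨_, rfl⟩
  obtain ⟨B, hB⟩ : ∃ B, B = ∫ x : ℝ, (deriv φ x) ^ 2 := ⟨_, rfl⟩
  have hB0 : 0 ≤ B := hB ▸ integral_nonneg (fun x => sq_nonneg _)
  have hsq : HasCompactSupport (fun x => (φ x) ^ 2) := by
    simp only [sq]
    exact hcs.mul_left (f := φ)
  have hA0 : 0 < A := by
    rw [hA]
    exact (hφc.pow 2).integral_pos_of_hasCompactSupport_nonneg_nonzero hsq
      (fun x => sq_nonneg _) (x := 0) (by simp [h0])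
  obtain ⟨ε, hε⟩ : ∃ ε, ε = (-lam) / (2 - lam) := ⟨_, rfl⟩
  have hε0 : 0 < ε := hε ▸ div_pos (by linarith) (by linarith)
  obtain ⟨s, hs⟩ : ∃ s, s = Real.sqrt (ε * A / (B + 1)) := ⟨_, rfl⟩
  have hs0 : 0 < s := hs ▸ Real.sqrt_pos.2 (by positivity)
  have hss : s ^ 2 = ε * A / (B + 1) := hs ▸ Real.sq_sqrt (by positivity)
  obtain ⟨a, ha⟩ : ∃ a, a = Real.sqrt (s / A) := ⟨_, rfl⟩
  have ha0 : 0 < a := ha ▸ Real.sqrt_pos.2 (by positivity)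
  have haa : a ^ 2 = s / A := ha ▸ Real.sq_sqrt (by positivity)
  obtain ⟨ψ, hψ⟩ : ∃ ψ : Fin 3 → ℝ → ℝ,
    ψ = fun (j : Fin 3) (x : ℝ) => a * φ (s * x - (5 * (j : ℝ) + 3)) := ⟨_, rfl⟩
  have hψsm : ∀ j, ContDiff ℝ (⊤ : ℕ∞) (ψ j) := by
    intro j
    rw [hψ]
    exact contDiff_const.mul (hφ.comp ((contDiff_const.mul contDiff_id).sub contDiff_const))
  have hψder : ∀ j x, HasDerivAt (ψ j) (a * s * deriv φ (s * x - (5 * (j : ℝ) + 3))) x := by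
    intro j x
    have h1 : HasDerivAt (fun x : ℝ => s * x - (5 * (j : ℝ) + 3)) s x := by
      simpa using ((hasDerivAt_id x).const_mul s).sub_const (5 * (j : ℝ) + 3)
    have h2 := ((hφdiff (s * x - (5 * (j : ℝ) + 3))).hasDerivAt.comp x h1).const_mul a
    rw [hψ]
    exact h2.congr_deriv (by ring)
  have hderiv : ∀ j x, deriv (ψ j) x = a * s * deriv φ (s * x - (5 * (j : ℝ) + 3)) :=
    fun j x => (hψder j x).deriv
  have hsup : ∀ j x, ψ j x ≠ 0 → |s * x - (5 * (j : ℝ) + 3)| ≤ 2 := by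
    intro j x hx
    rw [hψ] at hx
    exact hs1 _ (right_ne_zero_of_mul hx)
  have hsupd : ∀ j x, deriv (ψ j) x ≠ 0 → |s * x - (5 * (j : ℝ) + 3)| ≤ 2 := by
    intro j x hx
    rw [hderiv] at hx
    exact hs2 _ (right_ne_zero_of_mul hx)
  have htsup : ∀ j, tsupport (ψ j) ⊆ Icc (1 / s) ((5 * (j : ℝ) + 5) / s) := by
    intro j
    refine closure_minimal ?_ isClosed_Icc
    intro x hx
    have := abs_le.1 (hsup j x hx)
    have hj : (0 : ℝ) ≤ (j : ℕ) := Nat.cast_nonneg _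
    constructor
    · rw [div_le_iff₀ hs0]; linarith
    · rw [le_div_iff₀ hs0]; linarith
  have hcomp : ∀ j, HasCompactSupport (ψ j) := fun j =>
    isCompact_Icc.of_isClosed_subset (isClosed_tsupport _) (htsup j)
  have hint1 : ∀ j, Integrable (fun x => (ψ j x) ^ 2) := by
    intro j
    refine ((hψsm j).continuous.pow 2).integrable_of_hasCompactSupport ?_
    simp only [sq]
    exact (hcomp j).mul_left (f := ψ j)
  have hint2 : ∀ j, Integrable (fun x => (deriv (ψ j) x) ^ 2) := by
    intro j
    refine (((hψsm j).continuous_deriv (by norm_cast)).pow 2).integrable_of_hasCompactSupport ?_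
    simp only [sq]
    exact (hcomp j).deriv.mul_left (f := deriv (ψ j))
  have hI1 : ∀ j, ∫ x : ℝ, (ψ j x) ^ 2 = 1 := by
    intro j
    have : ∀ x, (ψ j x) ^ 2 = a ^ 2 * (φ (s * x - (5 * (j : ℝ) + 3))) ^ 2 := by
      intro x; rw [hψ]; ring
    simp_rw [this]
    rw [integral_const_mul, aux_int φ s _ hs0, ← hA, haa]
    field_simp
  have hI2 : ∀ j, ∫ x : ℝ, (deriv (ψ j) x) ^ 2 ≤ ε := by
    intro j
    have : ∀ x, (deriv (ψ j) x) ^ 2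
        = (a ^ 2 * s ^ 2) * (deriv φ (s * x - (5 * (j : ℝ) + 3))) ^ 2 := by
      intro x; rw [hderiv]; ring
    simp_rw [this]
    rw [integral_const_mul, aux_int (deriv φ) s _ hs0, ← hB, haa, hss]
    have : s / A * (ε * A / (B + 1)) * (s⁻¹ * B) = ε * (B / (B + 1)) := by
      field_simp
    rw [this]
    have h1 : B / (B + 1) ≤ 1 := by
      rw [div_le_one (by linarith)]; linarith
    nlinarith
  have hdis : ∀ i j x, ψ i x ≠ 0 → ψ j x ≠ 0 → i = j :=
    fun i j x hi hj => aux_sep i j _ (hsup i x hi) (hsup j x hj)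
  have hdisd : ∀ i j x, deriv (ψ i) x ≠ 0 → deriv (ψ j) x ≠ 0 → i = j :=
    fun i j x hi hj => aux_sep i j _ (hsupd i x hi) (hsupd j x hj)
  have hLI : LinearIndependent ℝ ψ := by
    rw [Fintype.linearIndependent_iff]
    intro g hg
    have h1 := aux_sq ψ hdis hint1 g
    have h2 : ∀ x, ∑ j, g j * ψ j x = 0 := by
      intro x
      have := congrFun hg x
      simpa using this
    simp only [h2, hI1] at h1
    simp only [mul_one] at h1
    have h3 : ∑ j, g j ^ 2 = 0 := by rw [← h1]; simp
    intro i
    have := (Finset.sum_eq_zero_iff_of_nonneg (fun j _ => sq_nonneg (g j))).1 h3 i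
      (Finset.mem_univ _)
    exact pow_eq_zero_iff (two_ne_zero) |>.1 this
  refine ⟨ψ, hψsm, hcomp, ?_, ?_, hI1, ?_, ?_⟩
  · intro j x hx
    exact lt_of_lt_of_le (by positivity) (htsup j hx).1
  · intro i j hij
    rw [Set.disjoint_left]
    exact fun x hi hj => hij (hdis i j x hi hj)
  · rw [finrank_span_eq_card hLI]; simp
  · intro w hw
    obtain ⟨c, rfl⟩ := (Submodule.mem_span_range_iff_exists_fun ℝ).1 hw
    have e1 : ∀ x, (∑ j, c j • ψ j) x = ∑ j, c j * ψ j x := by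
      intro x; simp
    have e2 : ∀ x, deriv (∑ j, c j • ψ j) x = ∑ j, c j * deriv (ψ j) x := by
      intro x
      have : HasDerivAt (∑ j, c j • ψ j) (∑ j, c j • deriv (ψ j) x) x := by
        refine HasDerivAt.sum (fun j _ => ?_)
        exact ((hψder j x).differentiableAt.hasDerivAt).const_smul (c j)
      simpa using this.deriv
    simp_rw [e2, e1]
    rw [aux_sq ψ hdis hint1 c, aux_sq (fun j => deriv (ψ j)) hdisd hint2 c]
    simp only [hI1, mul_one]
    have hle : ∑ j, c j ^ 2 * ∫ x : ℝ, (deriv (ψ j) x) ^ 2 ≤ ε * ∑ j, c j ^ 2 := by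
      rw [Finset.mul_sum]
      refine Finset.sum_le_sum (fun j _ => ?_)
      rw [mul_comm ε]
      exact mul_le_mul_of_nonneg_left (hI2 j) (sq_nonneg _)
    have he : ε * (2 - lam) = -lam := by
      rw [hε]; exact div_mul_cancel₀ _ (by linarith)
    generalize (∑ j, c j ^ 2 * ∫ x : ℝ, (deriv (ψ j) x) ^ 2) = D at hle ⊢
    generalize (∑ j, c j ^ 2) = M at hle ⊢
    have h5 : (2 - lam) * D ≤ (2 - lam) * (ε * M) :=
      mul_le_mul_of_nonneg_left hle (by linarith)
    have h6 : (2 - lam) * (ε * M) = -lam * M := by rw [← he]; ring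
    linarith
end

section
/- Let p > 6 and μ > 0. Then there exist k₀ > 0 and α > 0 with the following property: for every ρ ∈ [1/2, 1], every ℓ > 0, and every continuously differentiable function u : ℝ → ℝ with u and u' square-integrable, ∫_ℝ u² dx = μ and ∫_ℝ |u'|² dx = k₀, the function |u|^p is integrable on ℝ and (1/2)∫_ℝ |u'|² dx − (ρ/p)∫_0^ℓ |u|^p dx ≥ α. -/
open MeasureTheory Set Filter

theorem sup_aux (u : ℝ → ℝ) (s : ℝ) (hs : 0 < s) (hu : ContDiff ℝ 1 u)
    (h1 : Integrable (fun x : ℝ => (u x) ^ 2))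
    (h2 : Integrable (fun x : ℝ => (deriv u x) ^ 2)) (x : ℝ) :
    (u x) ^ 2 ≤ s * (∫ x : ℝ, (u x) ^ 2) + s⁻¹ * (∫ x : ℝ, (deriv u x) ^ 2) := by
  have hd : ∀ y, HasDerivAt (fun y => (u y) ^ 2) (2 * u y * deriv u y) y := by
    intro y
    have := ((hu.differentiable (by norm_num)) y).hasDerivAt.fun_pow 2
    simpa using this
  have hc : Continuous (fun y => 2 * u y * deriv u y) :=
    (continuous_const.mul hu.continuous).mul (hu.continuous_deriv (by norm_num))
  have hb : Integrable (fun y => s * (u y) ^ 2 + s⁻¹ * (deriv u y) ^ 2) :=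
    (h1.const_mul s).add (h2.const_mul s⁻¹)
  have key : ∀ y, |2 * u y * deriv u y| ≤ s * (u y) ^ 2 + s⁻¹ * (deriv u y) ^ 2 := by
    intro y
    have e1 : 0 ≤ s⁻¹ * (s * u y - deriv u y) ^ 2 := by positivity
    have e2 : 0 ≤ s⁻¹ * (s * u y + deriv u y) ^ 2 := by positivity
    have e3 : s⁻¹ * (s * u y - deriv u y) ^ 2
        = s * (u y) ^ 2 + s⁻¹ * (deriv u y) ^ 2 - 2 * u y * deriv u y := by
      field_simp; ring
    have e4 : s⁻¹ * (s * u y + deriv u y) ^ 2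
        = s * (u y) ^ 2 + s⁻¹ * (deriv u y) ^ 2 + 2 * u y * deriv u y := by
      field_simp; ring
    rw [abs_le]; constructor <;> linarith
  have hi : Integrable (fun y => 2 * u y * deriv u y) :=
    hb.mono' hc.aestronglyMeasurable (ae_of_all _ key)
  have hlim := tendsto_zero_of_hasDerivAt_of_integrableOn_Iic (a := x)
    (fun y _ => hd y) hi.integrableOn h1.integrableOn
  have hF := integral_Iic_of_hasDerivAt_of_tendsto' (a := x)
    (fun y _ => hd y) hi.integrableOn hlim
  calc (u x) ^ 2 = ∫ y in Iic x, 2 * u y * deriv u y := by rw [hF]; ring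
    _ ≤ ∫ y in Iic x, (s * (u y) ^ 2 + s⁻¹ * (deriv u y) ^ 2) :=
        integral_mono hi.integrableOn hb.integrableOn (fun y => (le_abs_self _).trans (key y))
    _ ≤ ∫ y, (s * (u y) ^ 2 + s⁻¹ * (deriv u y) ^ 2) :=
        setIntegral_le_integral hb (ae_of_all _ fun y => by
          simp only [Pi.zero_apply]; positivity)
    _ = _ := by
        rw [integral_add (h1.const_mul s) (h2.const_mul s⁻¹), integral_const_mul,
          integral_const_mul]

/-- Estimate (3.2) in the proof of Lemma 3.1 of the paper, on the real line with compact
core `[0, ℓ]`: for `p > 6` and `μ > 0` there are `k₀, α > 0` such that, uniformly in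
`ρ ∈ [1/2, 1]` and in the core, every `H¹` function of mass `μ` and kinetic energy `k₀`
has energy `E_ρ(u) ≥ α`. -/
theorem stmt_6 (p μ : ℝ) (hp : 6 < p) (hμ : 0 < μ) :
    ∃ k₀ > (0 : ℝ), ∃ α > (0 : ℝ),
      ∀ ρ ∈ Set.Icc (1 / 2 : ℝ) 1, ∀ ℓ > (0 : ℝ), ∀ u : ℝ → ℝ,
        ContDiff ℝ 1 u →
        Integrable (fun x : ℝ => (u x) ^ 2) →
        Integrable (fun x : ℝ => (deriv u x) ^ 2) →
        (∫ x : ℝ, (u x) ^ 2) = μ →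
        (∫ x : ℝ, (deriv u x) ^ 2) = k₀ →
        Integrable (fun x : ℝ => |u x| ^ p) ∧
        α ≤ (1 / 2) * (∫ x : ℝ, (deriv u x) ^ 2)
              - (ρ / p) * (∫ x in (0 : ℝ)..ℓ, |u x| ^ p) := by
  obtain ⟨t, ht, htr⟩ : ∃ t > (0 : ℝ), t ^ ((p - 6) / 2) = p / (16 * μ ^ 2) := by
    have hc : 0 < p / (16 * μ ^ 2) := by
      have : 0 < p := by linarith
      positivity
    refine ⟨(p / (16 * μ ^ 2)) ^ ((p - 6) / 2)⁻¹, Real.rpow_pos_of_pos hc _, ?_⟩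
    rw [Real.rpow_inv_rpow hc.le (by linarith)]
  have hp0 : 0 < p := by linarith
  have htq : t ^ ((p - 2) / 2) = p / (16 * μ ^ 2) * t ^ 2 := by
    rw [show (p - 2) / 2 = (p - 6) / 2 + (2 : ℕ) by push_cast; ring, Real.rpow_add ht, htr,
      Real.rpow_natCast]
  refine ⟨(t / (2 * μ)) ^ 2 * μ, by positivity, (t / (2 * μ)) ^ 2 * μ / 4, by positivity, ?_⟩
  intro ρ hρ ℓ hℓ u hu h1 h2 hm hk
  have hsup : ∀ x, (u x) ^ 2 ≤ t := by
    intro x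
    have := sup_aux u (t / (2 * μ)) (by positivity) hu h1 h2 x
    rw [hm, hk] at this
    refine this.trans (le_of_eq ?_)
    field_simp
    ring
  have hpt : ∀ x, |u x| ^ p ≤ t ^ ((p - 2) / 2) * (u x) ^ 2 := by
    intro x
    have e : |u x| ^ p = ((u x) ^ 2) ^ ((p - 2) / 2) * (u x) ^ 2 := by
      rw [← sq_abs (u x), ← Real.rpow_natCast, ← Real.rpow_mul (abs_nonneg _),
        ← Real.rpow_add_of_nonneg (abs_nonneg _)]
      · congr 1
        push_cast; ring
      · push_cast; linarith
      · push_cast; linarith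
    rw [e]
    exact mul_le_mul_of_nonneg_right
      (Real.rpow_le_rpow (sq_nonneg _) (hsup x) (by linarith)) (sq_nonneg _)
  have hnn : ∀ x, 0 ≤ |u x| ^ p := fun x => Real.rpow_nonneg (abs_nonneg _) _
  have hcont : Continuous (fun x => |u x| ^ p) :=
    hu.continuous.abs.rpow_const (fun x => Or.inr hp0.le)
  have hI : Integrable (fun x : ℝ => |u x| ^ p) :=
    (h1.const_mul (t ^ ((p - 2) / 2))).mono' hcont.aestronglyMeasurable
      (ae_of_all _ fun x => by rw [Real.norm_of_nonneg (hnn x)]; exact hpt x)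
  refine ⟨hI, ?_⟩
  have hle : (∫ x in (0 : ℝ)..ℓ, |u x| ^ p) ≤ p / (16 * μ ^ 2) * t ^ 2 * μ := by
    rw [intervalIntegral.integral_of_le hℓ.le]
    calc _ ≤ ∫ x, |u x| ^ p := setIntegral_le_integral hI (ae_of_all _ hnn)
      _ ≤ ∫ x, t ^ ((p - 2) / 2) * (u x) ^ 2 := integral_mono hI (h1.const_mul _) hpt
      _ = _ := by rw [integral_const_mul, hm, htq]
  have h0 : 0 ≤ ∫ x in (0 : ℝ)..ℓ, |u x| ^ p :=
    intervalIntegral.integral_nonneg hℓ.le (fun x _ => hnn x)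
  have h3 : (ρ / p) * (∫ x in (0 : ℝ)..ℓ, |u x| ^ p)
      ≤ (1 / p) * (p / (16 * μ ^ 2) * t ^ 2 * μ) := by
    have hρ1 := hρ.2
    gcongr
  have h4 : (1 / p) * (p / (16 * μ ^ 2) * t ^ 2 * μ) = (t / (2 * μ)) ^ 2 * μ / 4 := by
    field_simp
    ring
  rw [hk]
  linarith
end

section
/- Let p > 6, μ > 0 and ℓ > 0. Then for every ρ ≥ 1/2 and every M ∈ ℝ there exists an infinitely differentiable function u : ℝ → ℝ, compactly supported in the open interval (0, ℓ), with ∫_ℝ u² dx = μ and (1/2)∫_ℝ |u'|² dx − (ρ/p)∫_0^ℓ |u|^p dx < M. In particular, for p > 6 the functional E_ρ(u) = (1/2)∫_ℝ |u'|² dx − (ρ/p)∫_0^ℓ |u|^p dx is unbounded from below on the set of functions of mass μ. -/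
open MeasureTheory Set Filter

theorem scale_aux (g : ℝ → ℝ) (a b : ℝ) (ha : 0 < a) :
    ∫ x : ℝ, g (a * (x - b)) = a⁻¹ * ∫ x : ℝ, g x := by
  rw [integral_sub_right_eq_self (fun x => g (a * x)) b, Measure.integral_comp_mul_left]
  simp [abs_of_pos ha]

theorem pow_aux (p A B : ℝ) (hp : 6 < p) (hB : 0 < B) (M : ℝ) :
    ∃ s : ℝ, 1 ≤ s ∧ s ^ 4 * (A - B * s ^ (p - 6)) < M := by
  have h1 : Tendsto (fun s : ℝ => s ^ (p - 6)) atTop atTop :=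
    tendsto_rpow_atTop (by linarith)
  have h2 : Tendsto (fun s : ℝ => A - B * s ^ (p - 6)) atTop atBot := by
    have := tendsto_atBot_add_const_left atTop A
      (tendsto_neg_atTop_atBot.comp (h1.const_mul_atTop hB))
    simpa [sub_eq_add_neg, Function.comp_def] using this
  have h3 : Tendsto (fun s : ℝ => s ^ 4 * (A - B * s ^ (p - 6))) atTop atBot :=
    (tendsto_pow_atTop (by norm_num)).atTop_mul_atBot₀ h2
  obtain ⟨s, hs, hs'⟩ := ((eventually_ge_atTop (1:ℝ)).and (h3.eventually_lt_atBot M)).exists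
  exact ⟨s, hs, hs'⟩

/-- The `L²`-supercritical unboundedness from below of the constrained energy (inside
Lemma 3.1 of the paper), on the real line with compact core `[0, ℓ]`: for `p > 6`, any
`ρ ≥ 1/2` and any `M`, there is a smooth function of mass `μ`, compactly supported in
`(0, ℓ)`, whose energy `E_ρ` is below `M`. -/
theorem stmt_7 (p μ ℓ : ℝ) (hp : 6 < p) (hμ : 0 < μ) (hℓ : 0 < ℓ) :
    ∀ ρ : ℝ, 1 / 2 ≤ ρ → ∀ M : ℝ,
      ∃ u : ℝ → ℝ,
        ContDiff ℝ (⊤ : ℕ∞) u ∧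
        HasCompactSupport u ∧
        tsupport u ⊆ Set.Ioo 0 ℓ ∧
        (∫ x : ℝ, (u x) ^ 2) = μ ∧
        (1 / 2) * (∫ x : ℝ, (deriv u x) ^ 2)
          - (ρ / p) * (∫ x in (0 : ℝ)..ℓ, |u x| ^ p) < M := by
  intro ρ hρ M
  let f : ContDiffBump (0 : ℝ) := ⟨ℓ / 8, ℓ / 4, by positivity, by linarith⟩
  have hfc : Continuous (f : ℝ → ℝ) := f.continuous
  have hf0 : f 0 = 1 := f.one_of_mem_closedBall (by simp [f]; positivity)
  have hcs : HasCompactSupport (f : ℝ → ℝ) := f.hasCompactSupport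
  have hp0 : 0 < p := by linarith
  have hA : 0 < ∫ x, (f x) ^ 2 := by
    apply Continuous.integral_pos_of_hasCompactSupport_nonneg_nonzero (x := 0) (by fun_prop)
    · exact hcs.comp_left (g := fun y : ℝ => y ^ 2) (by simp)
    · intro x; positivity
    · simp [hf0]
  have hC : 0 < ∫ x, |f x| ^ p := by
    apply Continuous.integral_pos_of_hasCompactSupport_nonneg_nonzero (x := 0)
    · exact hfc.abs.rpow_const (fun x => Or.inr hp0.le)
    · exact hcs.comp_left (g := fun y : ℝ => |y| ^ p) (by simp [hp0.ne'])
    · intro x; positivity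
    · simp [hf0]
  set A := ∫ x, (f x) ^ 2 with hAd
  set C := ∫ x, |f x| ^ p with hCd
  set B := ∫ x, (deriv f x) ^ 2 with hBd
  set c := Real.sqrt (μ / A) with hc
  have hc0 : 0 < c := by positivity
  have hc2 : c ^ 2 * A = μ := by
    rw [hc, Real.sq_sqrt (by positivity)]; field_simp
  have hρ0 : 0 < ρ := by linarith
  obtain ⟨s, hs1, hsM⟩ := pow_aux p (1 / 2 * (c ^ 2 * B)) (ρ / p * (c ^ p * C)) hp
    (by positivity) M
  have hs0 : 0 < s := by linarith
  have hsupp : Function.support (fun x : ℝ => c * s * f (s ^ 2 * (x - ℓ / 2)))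
      ⊆ Icc (ℓ / 4) (3 * ℓ / 4) := by
    intro x hx
    have hx1 : f (s ^ 2 * (x - ℓ / 2)) ≠ 0 := by
      intro h; simp [h] at hx
    have hx2 : s ^ 2 * (x - ℓ / 2) ∈ Metric.ball (0 : ℝ) (ℓ / 4) := by
      have := f.support_eq
      have h3 : s ^ 2 * (x - ℓ / 2) ∈ Function.support f := hx1
      rw [this] at h3
      exact h3
    rw [mem_ball_zero_iff, Real.norm_eq_abs, abs_mul, abs_of_pos (by positivity : 0 < s ^ 2)] at hx2
    have h4 : |x - ℓ / 2| ≤ ℓ / 4 := by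
      have : 1 ≤ s ^ 2 := one_le_pow₀ hs1
      nlinarith [abs_nonneg (x - ℓ / 2)]
    rw [abs_le] at h4
    constructor <;> linarith [h4.1, h4.2]
  have htsupp : tsupport (fun x : ℝ => c * s * f (s ^ 2 * (x - ℓ / 2)))
      ⊆ Icc (ℓ / 4) (3 * ℓ / 4) := closure_minimal hsupp isClosed_Icc
  refine ⟨fun x => c * s * f (s ^ 2 * (x - ℓ / 2)), ?_, ?_, ?_, ?_, ?_⟩
  · exact contDiff_const.mul (f.contDiff.comp (by fun_prop))
  · exact isCompact_Icc.of_isClosed_subset (isClosed_tsupport _) htsupp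
  · intro x hx
    have := htsupp hx
    constructor <;> linarith [this.1, this.2]
  · have := scale_aux (fun y => (c * s) ^ 2 * (f y) ^ 2) (s ^ 2) (ℓ / 2) (by positivity)
    simp only [mul_pow (c * s)]
    rw [this, integral_const_mul, ← hAd, ← hc2]
    field_simp
  · have hd : ∀ x, deriv (fun x => c * s * f (s ^ 2 * (x - ℓ / 2))) x
        = c * s ^ 3 * deriv f (s ^ 2 * (x - ℓ / 2)) := by
      intro x
      have h1 : HasDerivAt f (deriv f (s ^ 2 * (x - ℓ / 2))) (s ^ 2 * (x - ℓ / 2)) :=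
        ((f.contDiff (n := 1)).differentiable (by norm_num) _).hasDerivAt
      have h2 : HasDerivAt (fun x => s ^ 2 * (x - ℓ / 2)) (s ^ 2 * 1) x :=
        ((hasDerivAt_id x).sub_const _).const_mul _
      have h3 := (h1.comp x h2).const_mul (c * s)
      have h4 := h3.deriv
      simp only [Function.comp_def] at h4
      rw [h4]; ring
    have hD : ∫ x, (deriv (fun x => c * s * f (s ^ 2 * (x - ℓ / 2))) x) ^ 2
        = s ^ 4 * (c ^ 2 * B) := by
      simp only [hd]
      have := scale_aux (fun y => (c * s ^ 3) ^ 2 * (deriv f y) ^ 2) (s ^ 2) (ℓ / 2) (by positivity)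
      simp only [mul_pow (c * s ^ 3)]
      rw [this, integral_const_mul, ← hBd]
      field_simp
    have hP : ∫ x in (0 : ℝ)..ℓ, |c * s * f (s ^ 2 * (x - ℓ / 2))| ^ p
        = s ^ 4 * (c ^ p * C * s ^ (p - 6)) := by
      rw [intervalIntegral.integral_eq_integral_of_support_subset]
      · have := scale_aux (fun y => (c * s) ^ p * |f y| ^ p) (s ^ 2) (ℓ / 2) (by positivity)
        have he : ∀ x, |c * s * f (s ^ 2 * (x - ℓ / 2))| ^ p
            = (c * s) ^ p * |f (s ^ 2 * (x - ℓ / 2))| ^ p := by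
          intro x
          rw [abs_mul, abs_of_pos (by positivity : 0 < c * s),
            Real.mul_rpow (by positivity) (by positivity)]
        simp only [he]
        rw [this, integral_const_mul, ← hCd, Real.mul_rpow hc0.le hs0.le,
          Real.rpow_sub hs0, show (6 : ℝ) = ((6 : ℕ) : ℝ) by norm_num, Real.rpow_natCast]
        field_simp
      · intro x hx
        have : x ∈ Icc (ℓ / 4) (3 * ℓ / 4) := by
          apply hsupp
          intro h
          apply hx
          simp only at h
          simp only [h, abs_zero, Real.zero_rpow hp0.ne']
        constructor <;> linarith [this.1, this.2]
    rw [hD, hP]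
    calc _ = _ := by ring
      _ < M := hsM
end
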